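/- arXiv:2406.07403 — 3 statements merged into one kernel-verified Lean document; each statement's English description precedes it below -/
import Mathlib

section
/- Let T > 0, r₁ > 0, r₂ > 0, α ∈ (0,1), and let u₁, u₂ : [0,T] → ℝ be continuous functions with u₁(t) ≥ 0 and u₂(t) ≥ 0 for all t. If λ₁, λ₂ : [0,T] → ℝ are differentiable functions satisfying the adjoint system λ₁'(t) = −α + r₁λ₁(t) − u₂(t)λ₂(t) and λ₂'(t) = −(1−α) − u₁(t)λ₁(t) + r₂λ₂(t) on [0,T] together with the terminal conditions λ₁(T) = 0 and λ₂(T) = 0, then λ₁(t) > 0 and λ₂(t) > 0 for all t ∈ [0,T). -/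
open Set Filter Topology

/-- Near a zero where the derivative is negative, the function has the sign opposite to that of
the increment. -/
lemma eventually_mul_sub_neg_of_hasDerivAt {f : ℝ → ℝ} {f' s : ℝ} (hf : HasDerivAt f f' s)
    (hs : f s = 0) (hf' : f' < 0) : ∀ᶠ t in 𝓝[≠] s, f t * (t - s) < 0 := by
  filter_upwards [(hasDerivAt_iff_tendsto_slope.1 hf).eventually_lt_const hf',
    self_mem_nhdsWithin] with t ht hne
  have hne : t - s ≠ 0 := sub_ne_zero.2 hne
  rw [slope_def_field, hs, sub_zero] at ht
  have h := mul_neg_of_neg_of_pos ht (pow_pos (abs_pos.2 hne) 2)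
  rw [sq_abs] at h
  calc f t * (t - s) = f t / (t - s) * (t - s) ^ 2 := by field_simp
    _ < 0 := h

lemma eventually_pos_left_of_hasDerivAt {f : ℝ → ℝ} {f' s : ℝ} (hf : HasDerivAt f f' s)
    (hs : f s = 0) (hf' : f' < 0) : ∀ᶠ t in 𝓝[<] s, 0 < f t := by
  filter_upwards [(eventually_mul_sub_neg_of_hasDerivAt hf hs hf').filter_mono
    (nhdsWithin_mono _ fun _ h => ne_of_lt h), self_mem_nhdsWithin] with t ht hlt
  exact pos_of_mul_neg_left ht (sub_neg.2 hlt).le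

lemma eventually_neg_right_of_hasDerivAt {f : ℝ → ℝ} {f' s : ℝ} (hf : HasDerivAt f f' s)
    (hs : f s = 0) (hf' : f' < 0) : ∀ᶠ t in 𝓝[>] s, f t < 0 := by
  filter_upwards [(eventually_mul_sub_neg_of_hasDerivAt hf hs hf').filter_mono
    (nhdsWithin_mono _ fun _ h => ne_of_gt h), self_mem_nhdsWithin] with t ht hlt
  exact neg_of_mul_neg_left ht (sub_pos.2 hlt).le

/-- positivity of the adjoint variables of the marriage
optimal-control model on `[0, T)`. -/
theorem adjoint_positive
    (T r₁ r₂ α : ℝ) (hT : 0 < T) (hr₁ : 0 < r₁) (hr₂ : 0 < r₂)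
    (hα : α ∈ Set.Ioo (0 : ℝ) 1)
    (u₁ u₂ : ℝ → ℝ)
    (hu₁c : ContinuousOn u₁ (Set.Icc 0 T)) (hu₂c : ContinuousOn u₂ (Set.Icc 0 T))
    (hu₁ : ∀ t ∈ Set.Icc 0 T, 0 ≤ u₁ t) (hu₂ : ∀ t ∈ Set.Icc 0 T, 0 ≤ u₂ t)
    (l₁ l₂ : ℝ → ℝ)
    (hl₁ : ∀ t ∈ Set.Icc 0 T,
      HasDerivAt l₁ (-α + r₁ * l₁ t - u₂ t * l₂ t) t)
    (hl₂ : ∀ t ∈ Set.Icc 0 T,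
      HasDerivAt l₂ (-(1 - α) - u₁ t * l₁ t + r₂ * l₂ t) t)
    (hterm₁ : l₁ T = 0) (hterm₂ : l₂ T = 0) :
    ∀ t ∈ Set.Ico 0 T, 0 < l₁ t ∧ 0 < l₂ t := by
  obtain ⟨hα0, hα1⟩ := hα
  have hTT : T ∈ Icc 0 T := ⟨hT.le, le_rfl⟩
  have near : ∀ᶠ t in 𝓝[<] T, 0 < l₁ t ∧ 0 < l₂ t :=
    (eventually_pos_left_of_hasDerivAt (hl₁ T hTT) hterm₁
      (by rw [hterm₁, hterm₂]; linarith)).and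
    (eventually_pos_left_of_hasDerivAt (hl₂ T hTT) hterm₂
      (by rw [hterm₁, hterm₂]; linarith))
  obtain ⟨c, hcT, hc⟩ := (mem_nhdsLT_iff_exists_Ioo_subset).1 near
  rw [mem_Iio] at hcT
  by_contra! hcon
  obtain ⟨t₀, ht₀, hbad⟩ := hcon
  have hsub : Icc 0 c ⊆ Icc 0 T := Icc_subset_Icc_right hcT.le
  have c₁ : ContinuousOn l₁ (Icc 0 c) := fun t ht =>
    (hl₁ t (hsub ht)).continuousAt.continuousWithinAt
  have c₂ : ContinuousOn l₂ (Icc 0 c) := fun t ht =>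
    (hl₂ t (hsub ht)).continuousAt.continuousWithinAt
  have hmin : ContinuousOn (fun t => min (l₁ t) (l₂ t)) (Icc 0 c) :=
    ContinuousOn.inf c₁ c₂
  have hK : IsCompact (Icc 0 c ∩ (fun t => min (l₁ t) (l₂ t)) ⁻¹' Iic 0) :=
    isCompact_Icc.of_isClosed_subset
      (hmin.preimage_isClosed_of_isClosed isClosed_Icc isClosed_Iic) inter_subset_left
  have ht₀c : t₀ ≤ c := by
    by_contra! h
    have := hc ⟨h, ht₀.2⟩
    exact (hbad this.1).not_gt this.2
  have hne : (Icc 0 c ∩ (fun t => min (l₁ t) (l₂ t)) ⁻¹' Iic 0).Nonempty := by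
    refine ⟨t₀, ⟨ht₀.1, ht₀c⟩, ?_⟩
    rw [mem_preimage, mem_Iic, min_le_iff]
    by_cases h : 0 < l₁ t₀
    · exact Or.inr (hbad h)
    · exact Or.inl (not_lt.1 h)
  obtain ⟨s, ⟨hs, hs0⟩, hmax⟩ := hK.exists_isGreatest hne
  have hsT : s < T := hs.2.trans_lt hcT
  have hsI : s ∈ Icc 0 T := hsub hs
  have hpos : ∀ᶠ t in 𝓝[>] s, 0 < l₁ t ∧ 0 < l₂ t := by
    filter_upwards [Ioo_mem_nhdsGT hsT] with t ht
    rcases lt_or_ge c t with h | h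
    · exact hc ⟨h, ht.2⟩
    · rw [← lt_min_iff]
      by_contra! h'
      exact (hmax ⟨⟨hs.1.trans ht.1.le, h⟩, h'⟩).not_gt ht.1
  have hn₁ : 0 ≤ l₁ s :=
    ge_of_tendsto ((hl₁ s hsI).continuousAt.tendsto.mono_left nhdsWithin_le_nhds)
      (hpos.mono fun _ h => h.1.le)
  have hn₂ : 0 ≤ l₂ s :=
    ge_of_tendsto ((hl₂ s hsI).continuousAt.tendsto.mono_left nhdsWithin_le_nhds)
      (hpos.mono fun _ h => h.2.le)
  have hp₁ := mul_nonneg (hu₁ s hsI) hn₁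
  have hp₂ := mul_nonneg (hu₂ s hsI) hn₂
  rw [mem_preimage, mem_Iic, min_le_iff] at hs0
  rcases hs0 with h | h
  · have h0 : l₁ s = 0 := le_antisymm h hn₁
    have hneg := eventually_neg_right_of_hasDerivAt (hl₁ s hsI) h0
      (by rw [h0]; linarith)
    obtain ⟨t, ht, ht'⟩ := (hneg.and hpos).exists
    exact ht.not_gt ht'.1
  · have h0 : l₂ s = 0 := le_antisymm h hn₂
    have hneg := eventually_neg_right_of_hasDerivAt (hl₂ s hsI) h0
      (by rw [h0]; linarith)
    obtain ⟨t, ht, ht'⟩ := (hneg.and hpos).exists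
    exact ht.not_gt ht'.2
end

section
/- Let T > 0, r₁ > 0, r₂ > 0, α ∈ [0,1], and let u₁, u₂ : [0,T] → ℝ be continuous functions with u₁(t) ≥ 0 and u₂(t) ≥ 0 for all t. If λ₁, λ₂ : [0,T] → ℝ are differentiable functions satisfying λ₁'(t) = −α + r₁λ₁(t) − u₂(t)λ₂(t) and λ₂'(t) = −(1−α) − u₁(t)λ₁(t) + r₂λ₂(t) on [0,T] with λ₁(T) = 0 and λ₂(T) = 0, then λ₁(t) ≥ 0 and λ₂(t) ≥ 0 for all t ∈ [0,T]. -/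
theorem hasDerivAt_min_zero_sq (x : ℝ) :
    HasDerivAt (fun y : ℝ => min y 0 ^ 2) (2 * min x 0) x := by
  rw [hasDerivAt_iff_isLittleO]
  refine (Asymptotics.IsBigO.of_bound 1 (Filter.Eventually.of_forall fun y => ?_)).trans_isLittleO
    (Asymptotics.isLittleO_pow_sub_sub x one_lt_two)
  rw [one_mul, norm_pow, norm_norm, Real.norm_eq_abs, Real.norm_eq_abs, sq_abs, smul_eq_mul,
    abs_le]
  rcases le_total x 0 with hx | hx <;> rcases le_total y 0 with hy | hy <;>
    simp only [min_eq_left, min_eq_right, hx, hy] <;> constructor <;> nlinarith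

/-- A nonnegative function with `V' ≥ -K V` that vanishes at the right endpoint vanishes on the
whole interval. -/
theorem eq_zero_of_neg_mul_le_deriv {V V' : ℝ → ℝ} {K a b : ℝ}
    (hV : ∀ t ∈ Set.Icc a b, HasDerivAt V (V' t) t) (hnonneg : ∀ t ∈ Set.Icc a b, 0 ≤ V t)
    (hb : V b = 0) (bound : ∀ t ∈ Set.Icc a b, -K * V t ≤ V' t) :
    ∀ t ∈ Set.Icc a b, V t = 0 := by
  have hd : ∀ t ∈ Set.Icc a b, HasDerivAt (fun s => V s * Real.exp (K * s))
      (V' t * Real.exp (K * t) + V t * (Real.exp (K * t) * (K * 1))) t := fun t ht =>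
    (hV t ht).mul (((hasDerivAt_id t).const_mul K).exp)
  have hmono : MonotoneOn (fun s => V s * Real.exp (K * s)) (Set.Icc a b) := by
    refine monotoneOn_of_deriv_nonneg (convex_Icc a b)
      (fun t ht => (hd t ht).continuousAt.continuousWithinAt)
      (fun t ht => (hd t (interior_subset ht)).differentiableAt.differentiableWithinAt)
      fun t ht => ?_
    rw [(hd t (interior_subset ht)).deriv]
    nlinarith [bound t (interior_subset ht), Real.exp_pos (K * t)]
  intro t ht
  have h := hmono ht (Set.right_mem_Icc.2 (ht.1.trans ht.2)) ht.2
  simp only [hb, zero_mul] at h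
  exact le_antisymm (nonpos_of_mul_nonpos_left h (Real.exp_pos _)) (hnonneg t ht)


/-- nonnegativity of the adjoint variables of the marriage
optimal-control model on `[0, T]`. -/
theorem adjoint_nonneg
    (T r₁ r₂ α : ℝ) (hT : 0 < T) (hr₁ : 0 < r₁) (hr₂ : 0 < r₂)
    (hα : α ∈ Set.Icc (0 : ℝ) 1)
    (u₁ u₂ : ℝ → ℝ)
    (hu₁c : ContinuousOn u₁ (Set.Icc 0 T)) (hu₂c : ContinuousOn u₂ (Set.Icc 0 T))
    (hu₁ : ∀ t ∈ Set.Icc 0 T, 0 ≤ u₁ t) (hu₂ : ∀ t ∈ Set.Icc 0 T, 0 ≤ u₂ t)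
    (l₁ l₂ : ℝ → ℝ)
    (hl₁ : ∀ t ∈ Set.Icc 0 T,
      HasDerivAt l₁ (-α + r₁ * l₁ t - u₂ t * l₂ t) t)
    (hl₂ : ∀ t ∈ Set.Icc 0 T,
      HasDerivAt l₂ (-(1 - α) - u₁ t * l₁ t + r₂ * l₂ t) t)
    (hterm₁ : l₁ T = 0) (hterm₂ : l₂ T = 0) :
    ∀ t ∈ Set.Icc 0 T, 0 ≤ l₁ t ∧ 0 ≤ l₂ t := by
  obtain ⟨K, hK⟩ := isCompact_Icc.exists_bound_of_continuousOn (hu₁c.add hu₂c)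
  have hV := eq_zero_of_neg_mul_le_deriv (K := K)
    (V := fun t => min (l₁ t) 0 ^ 2 + min (l₂ t) 0 ^ 2)
    (fun t ht => ((hasDerivAt_min_zero_sq (l₁ t)).comp t (hl₁ t ht)).add
      ((hasDerivAt_min_zero_sq (l₂ t)).comp t (hl₂ t ht)))
    (fun t _ => by positivity) (by simp [hterm₁, hterm₂]) fun t ht => ?_
  · intro t ht
    have h := hV t ht
    rw [add_eq_zero_iff_of_nonneg (sq_nonneg _) (sq_nonneg _), sq_eq_zero_iff, sq_eq_zero_iff,
      min_eq_right_iff, min_eq_right_iff] at h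
    exact h
  · have hu : u₁ t + u₂ t ≤ K := (le_abs_self _).trans (hK t ht)
    have h₁ := hu₁ t ht
    have h₂ := hu₂ t ht
    have ha := min_le_right (l₁ t) 0
    have hb := min_le_right (l₂ t) 0
    have ha' := min_le_left (l₁ t) 0
    have hb' := min_le_left (l₂ t) 0
    have haa : min (l₁ t) 0 * l₁ t = min (l₁ t) 0 ^ 2 := by
      rcases min_choice (l₁ t) 0 with h | h <;> rw [h] <;> ring
    have hbb : min (l₂ t) 0 * l₂ t = min (l₂ t) 0 ^ 2 := by
      rcases min_choice (l₂ t) 0 with h | h <;> rw [h] <;> ring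
    generalize min (l₁ t) 0 = a at *
    generalize min (l₂ t) 0 = b at *
    have e₁ : 0 ≤ u₂ t * (-a * (l₂ t - b)) :=
      mul_nonneg h₂ (mul_nonneg (by linarith) (by linarith))
    have e₂ : 0 ≤ u₁ t * (-b * (l₁ t - a)) :=
      mul_nonneg h₁ (mul_nonneg (by linarith) (by linarith))
    have e₃ : 0 ≤ (u₁ t + u₂ t) * (a - b) ^ 2 := by positivity
    have e₄ : 0 ≤ (K - (u₁ t + u₂ t)) * (a ^ 2 + b ^ 2) :=
      mul_nonneg (by linarith) (by positivity)
    have e₅ : 0 ≤ α * -a := mul_nonneg hα.1 (by linarith)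
    have e₆ : 0 ≤ (1 - α) * -b := mul_nonneg (by linarith [hα.2]) (by linarith)
    have e₇ : 0 ≤ r₁ * (a * l₁ t) := by rw [haa]; positivity
    have e₈ : 0 ≤ r₂ * (b * l₂ t) := by rw [hbb]; positivity
    linarith
end

section
/- Let T > 0, r₂ > 0, α ∈ (0,1), and t ∈ [0,T). Then the quantity α / ( −(1−α)/r₂ + ((1−α)/r₂)e^{r₂(t−T)} ) is strictly negative; consequently it cannot equal any admissible control value u₂ ∈ [0, M₂] with M₂ > 0, and the requirement 0 = −α − u₂ · ((1−α)/r₂)(1 − e^{r₂(t−T)}) with u₂ ∈ [0, M₂] forces t ≥ T. Hence for α ∈ (0,1) there is no singular arc for u₁ on [0,T). -/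
/-- The adjoint `λ₂(t) = ((1 - α) / r) (1 - e^{r (t - T)})` is positive before the terminal time. -/
theorem adjoint_pos_of_lt {T r α t : ℝ} (hr : 0 < r) (hα : α < 1) (ht : t < T) :
    0 < ((1 - α) / r) * (1 - Real.exp (r * (t - T))) :=
  mul_pos (div_pos (sub_pos.2 hα) hr) <|
    sub_pos.2 <| Real.exp_lt_one_iff.2 <| mul_neg_of_pos_of_neg hr (sub_neg.2 ht)

/-- for `α ∈ (0,1)` and `t ∈ [0,T)`, the quantity
`α / (−(1−α)/r₂ + ((1−α)/r₂)e^{r₂(t−T)})` is strictly negative, hence cannot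
equal any admissible control `u₂ ∈ [0, M₂]`, and the singular-arc requirement
`0 = −α − u₂ λ₂(t)` with `u₂ ∈ [0, M₂]` forces `t ≥ T`: no singular arc for
`u₁` on `[0, T)`. -/
theorem no_singular_arc_alpha_interior
    (T r₂ α t : ℝ) (hT : 0 < T) (hr₂ : 0 < r₂)
    (hα : α ∈ Set.Ioo (0 : ℝ) 1) (ht : t ∈ Set.Ico 0 T) :
    α / (-(1 - α) / r₂ + ((1 - α) / r₂) * Real.exp (r₂ * (t - T))) < 0 ∧
    (∀ M₂ : ℝ, 0 < M₂ → ∀ u₂ ∈ Set.Icc 0 M₂,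
      u₂ ≠ α / (-(1 - α) / r₂ + ((1 - α) / r₂) * Real.exp (r₂ * (t - T)))) ∧
    (∀ M₂ : ℝ, 0 < M₂ → ∀ u₂ ∈ Set.Icc 0 M₂,
      0 = -α - u₂ * (((1 - α) / r₂) * (1 - Real.exp (r₂ * (t - T)))) →
      T ≤ t) := by
  have hpos := adjoint_pos_of_lt hr₂ hα.2 ht.2
  have hneg : α / (-(1 - α) / r₂ + ((1 - α) / r₂) * Real.exp (r₂ * (t - T))) < 0 := by
    refine div_neg_of_pos_of_neg hα.1 ?_
    rw [neg_div]
    linarith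
  refine ⟨hneg, fun M₂ _ u₂ hu₂ => (hneg.trans_le hu₂.1).ne', fun M₂ _ u₂ hu₂ h => ?_⟩
  linarith [mul_nonneg hu₂.1 hpos.le, hα.1]
end
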